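/- arXiv:2308.14642 — 2 statements merged into one kernel-verified Lean document; each statement's English description precedes it below -/
import Mathlib

section
/- Let A, B ∈ ℝ^{d×d} be symmetric positive definite matrices with A ⪯ B and det B ≤ 2·det A. Then for every u ∈ ℝ^d it holds that ‖u‖_{B^{-1}} ≤ ‖u‖_{A^{-1}} ≤ √2 · ‖u‖_{B^{-1}}. -/
open Matrix

open scoped MatrixOrder in
/-- A real matrix above the identity in the Loewner order is bounded above by its determinant. -/
theorem Matrix.PosSemidef.smul_one_sub_of_det_le {n : Type*} [Fintype n] [DecidableEq n]
    {M : Matrix n n ℝ} (hM : (M - 1).PosSemidef) {c : ℝ} (hdet : M.det ≤ c) :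
    (c • (1 : Matrix n n ℝ) - M).PosSemidef := by
  have hherm : M.IsHermitian := by
    simpa using hM.isHermitian.add (isHermitian_one (n := n) (α := ℝ))
  have hone : ∀ x ∈ spectrum ℝ M, 1 ≤ x :=
    (algebraMap_le_iff_le_spectrum (r := (1 : ℝ)) hherm).1
      (by simpa [Matrix.le_iff] using hM)
  rw [← Algebra.algebraMap_eq_smul_one, ← Matrix.le_iff, le_algebraMap_iff_spectrum_le hherm]
  rw [hherm.spectrum_real_eq_range_eigenvalues] at hone ⊢
  rintro _ ⟨i, rfl⟩
  calc hherm.eigenvalues i = ∏ j ∈ {i}, hherm.eigenvalues j := by simp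
    _ ≤ ∏ j, hherm.eigenvalues j :=
      Finset.prod_le_prod_of_subset_of_one_le (Finset.subset_univ _)
        (fun j _ ↦ zero_le_one.trans (hone _ ⟨j, rfl⟩)) (fun j _ _ ↦ hone _ ⟨j, rfl⟩)
    _ = M.det := by simp [hherm.det_eq_prod_eigenvalues]
    _ ≤ c := hdet

open scoped MatrixOrder in
/-- If `A ⪯ B` with `A` positive definite and `det B ≤ c det A`, then `B ⪯ c A`. -/
theorem Matrix.PosDef.smul_sub_posSemidef_of_det_le {n : Type*} [Fintype n] [DecidableEq n]
    {A B : Matrix n n ℝ} (hA : A.PosDef) (hAB : (B - A).PosSemidef) {c : ℝ}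
    (hdet : B.det ≤ c * A.det) : (c • A - B).PosSemidef := by
  have hpos := hA.det_pos
  obtain ⟨S, rfl⟩ := CStarAlgebra.nonneg_iff_eq_star_mul_self.mp hA.posSemidef.nonneg
  obtain ⟨U, rfl⟩ : IsUnit S := isUnit_of_mul_isUnit_right hA.isUnit
  obtain ⟨M, rfl⟩ : ∃ M, B = star (U : Matrix n n ℝ) * M * U :=
    ⟨star ((U⁻¹ : (Matrix n n ℝ)ˣ) : Matrix n n ℝ) * B *
      ((U⁻¹ : (Matrix n n ℝ)ˣ) : Matrix n n ℝ), by
      rw [← mul_assoc, ← mul_assoc, ← star_mul, Units.inv_mul, star_one, one_mul, mul_assoc,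
        Units.inv_mul, mul_one]⟩
  have hM : (M - 1).PosSemidef := by
    rw [← U.isUnit.posSemidef_star_left_conjugate_iff]
    simpa [mul_sub, sub_mul] using hAB
  have hdet' : M.det ≤ c := by
    refine le_of_mul_le_mul_right ?_ hpos
    simpa [det_mul, mul_comm, mul_left_comm] using hdet
  have := U.isUnit.posSemidef_star_left_conjugate_iff.2 (hM.smul_one_sub_of_det_le hdet')
  simpa [mul_sub, sub_mul] using this

/-- Inversion of positive definite matrices reverses the Loewner order. -/
theorem Matrix.PosDef.dotProduct_inv_mulVec_le {n : Type*} [Fintype n] [DecidableEq n]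
    {A B : Matrix n n ℝ} (hA : A.PosDef) (hB : B.PosDef) (hAB : (B - A).PosSemidef)
    (u : n → ℝ) : u ⬝ᵥ B⁻¹ *ᵥ u ≤ u ⬝ᵥ A⁻¹ *ᵥ u := by
  have hAx : A *ᵥ (A⁻¹ *ᵥ u) = u := by
    simp [mulVec_mulVec, mul_nonsing_inv _ ((isUnit_iff_isUnit_det _).1 hA.isUnit)]
  have hBy : B *ᵥ (B⁻¹ *ᵥ u) = u := by
    simp [mulVec_mulVec, mul_nonsing_inv _ ((isUnit_iff_isUnit_det _).1 hB.isUnit)]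
  set x := A⁻¹ *ᵥ u
  set y := B⁻¹ *ᵥ u
  have hsymm : x ⬝ᵥ A *ᵥ y = u ⬝ᵥ y := by
    have hAT : Aᵀ = A := by simpa using hA.isHermitian.eq
    rw [dotProduct_mulVec, ← mulVec_transpose, hAT, hAx]
  have hsq := hA.posSemidef.dotProduct_mulVec_nonneg (x - y)
  have hle := hAB.dotProduct_mulVec_nonneg y
  simp only [star_trivial, mulVec_sub, sub_mulVec, sub_dotProduct, dotProduct_sub, hAx, hBy,
    hsymm] at hsq hle
  linarith [dotProduct_comm x u, dotProduct_comm y u]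

/-- If `A ⪯ B` are symmetric positive definite with `det B ≤ 2 det A`, then
`‖u‖_{B⁻¹} ≤ ‖u‖_{A⁻¹} ≤ √2 ‖u‖_{B⁻¹}` for every vector `u`. -/
theorem stmt_2 (d : ℕ) (A B : Matrix (Fin d) (Fin d) ℝ)
    (hA : A.PosDef) (hB : B.PosDef)
    (hAB : (B - A).PosSemidef) (hdet : B.det ≤ 2 * A.det)
    (u : Fin d → ℝ) :
    Real.sqrt (u ⬝ᵥ B⁻¹.mulVec u) ≤ Real.sqrt (u ⬝ᵥ A⁻¹.mulVec u) ∧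
      Real.sqrt (u ⬝ᵥ A⁻¹.mulVec u) ≤ Real.sqrt 2 * Real.sqrt (u ⬝ᵥ B⁻¹.mulVec u) := by
  refine ⟨Real.sqrt_le_sqrt (hA.dotProduct_inv_mulVec_le hB hAB u), ?_⟩
  rw [← Real.sqrt_mul zero_le_two]
  refine Real.sqrt_le_sqrt ?_
  have h := hB.dotProduct_inv_mulVec_le (hA.smul (two_pos : (0 : ℝ) < 2))
    (hA.smul_sub_posSemidef_of_det_le hAB hdet) u
  have hinv : ((2 : ℝ) • A)⁻¹ = (2 : ℝ)⁻¹ • A⁻¹ :=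
    inv_smul' A (Units.mk0 (2 : ℝ) two_ne_zero) ((isUnit_iff_isUnit_det _).1 hA.isUnit)
  rw [hinv, smul_mulVec, dotProduct_smul, smul_eq_mul] at h
  linarith
end

section
/- Let d ≥ 1 and K ≥ 2 be integers, let φ_1, …, φ_K ∈ ℝ^d satisfy ‖φ_k‖ ≤ 1 for all k, and define Λ_k = I + Σ_{i=1}^{k−1} φ_i φ_iᵀ for k = 1,…,K. Then Σ_{k=1}^K ‖φ_k‖_{Λ_k^{-1}} ≤ 2·√(d·K·log K). -/
open Matrix Finset

/-- The regularized Gram matrix `I + ∑_{i ∈ s} φ_i φ_iᵀ`. -/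
def regGram {ι n : Type*} [DecidableEq n] (φ : ι → n → ℝ) (s : Finset ι) : Matrix n n ℝ :=
  1 + ∑ i ∈ s, vecMulVec (φ i) (φ i)

section

variable {ι n : Type*} [Fintype n] (φ : ι → n → ℝ)

lemma posSemidef_sum_vecMulVec_self (s : Finset ι) :
    (∑ i ∈ s, vecMulVec (φ i) (φ i)).PosSemidef :=
  posSemidef_sum _ fun i _ => by simpa using posSemidef_vecMulVec_self_star (φ i)

variable [DecidableEq n]

lemma regGram_posDef (s : Finset ι) : (regGram φ s).PosDef :=
  PosDef.one.add_posSemidef (posSemidef_sum_vecMulVec_self φ s)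

lemma det_regGram_insert [DecidableEq ι] {s : Finset ι} {k : ι} (hk : k ∉ s) :
    (regGram φ (insert k s)).det =
      (regGram φ s).det * (1 + φ k ⬝ᵥ (regGram φ s)⁻¹ *ᵥ φ k) := by
  have h := det_add_replicateCol_mul_replicateRow (ι := Unit)
    (regGram_posDef φ s).det_pos.ne'.isUnit (φ k) (φ k)
  have e : regGram φ (insert k s) =
      regGram φ s + replicateCol Unit (φ k) * replicateRow Unit (φ k) := by
    rw [regGram, sum_insert hk, regGram, vecMulVec_eq Unit]
    abel
  rw [e, h]
  congr 1
  rw [det_unique, dotProduct_mulVec, Matrix.mul_assoc, Matrix.add_apply,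
    Matrix.one_apply_eq, ← Matrix.mul_assoc]
  simp [Matrix.mul_apply, dotProduct, vecMul]

lemma dotProduct_self_le_regGram (s : Finset ι) (y : n → ℝ) :
    y ⬝ᵥ y ≤ y ⬝ᵥ regGram φ s *ᵥ y := by
  have h := (posSemidef_sum_vecMulVec_self φ s).dotProduct_mulVec_nonneg y
  rw [regGram, add_mulVec, one_mulVec, dotProduct_add]
  simpa using h

lemma inv_regGram_quadratic_nonneg (s : Finset ι) (v : n → ℝ) :
    0 ≤ v ⬝ᵥ (regGram φ s)⁻¹ *ᵥ v := by
  simpa using (regGram_posDef φ s).inv.posSemidef.dotProduct_mulVec_nonneg v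

lemma inv_regGram_quadratic_le_one (s : Finset ι) {v : n → ℝ} (hv : v ⬝ᵥ v ≤ 1) :
    v ⬝ᵥ (regGram φ s)⁻¹ *ᵥ v ≤ 1 := by
  set y := (regGram φ s)⁻¹ *ᵥ v with hy
  have hGy : regGram φ s *ᵥ y = v := by
    rw [hy, mulVec_mulVec, mul_nonsing_inv _ (regGram_posDef φ s).det_pos.ne'.isUnit, one_mulVec]
  have hle := dotProduct_self_le_regGram φ s y
  rw [hGy, dotProduct_comm y v] at hle
  have hcs : (v ⬝ᵥ y) ^ 2 ≤ (v ⬝ᵥ v) * (y ⬝ᵥ y) := by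
    simpa [dotProduct, sq] using sum_mul_sq_le_sq_mul_sq univ v y
  have hy0 : 0 ≤ y ⬝ᵥ y := by simpa using dotProduct_star_self_nonneg y
  nlinarith

lemma Matrix.PosDef.log_det_le {A : Matrix n n ℝ} (hA : A.PosDef) {c : ℝ} (hc : 0 < c) :
    Real.log A.det ≤ Fintype.card n * Real.log c + A.trace / c - Fintype.card n := by
  have hdet : A.det = ∏ i, hA.1.eigenvalues i := by simpa using hA.1.det_eq_prod_eigenvalues
  have htr : A.trace = ∑ i, hA.1.eigenvalues i := by simpa using hA.1.trace_eq_sum_eigenvalues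
  rw [hdet, htr, Real.log_prod fun i _ => (hA.eigenvalues_pos i).ne']
  calc ∑ i, Real.log (hA.1.eigenvalues i)
      ≤ ∑ i, (Real.log c + hA.1.eigenvalues i / c - 1) := by
        refine sum_le_sum fun i _ => ?_
        have h := Real.log_le_sub_one_of_pos (div_pos (hA.eigenvalues_pos i) hc)
        rw [Real.log_div (hA.eigenvalues_pos i).ne' hc.ne'] at h
        linarith
    _ = _ := by simp [sum_add_distrib, sum_sub_distrib, sum_div]

lemma trace_regGram_le (s : Finset ι) (hφ : ∀ i, φ i ⬝ᵥ φ i ≤ 1) :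
    (regGram φ s).trace ≤ Fintype.card n + #s := by
  have h : ∑ i ∈ s, φ i ⬝ᵥ φ i ≤ #s := by
    simpa using sum_le_sum fun i (_ : i ∈ s) => hφ i
  simpa [regGram, trace_sum, trace_vecMulVec] using h

end

lemma Real.le_two_mul_log_one_add {x : ℝ} (h0 : 0 ≤ x) (h1 : x ≤ 1) :
    x ≤ 2 * Real.log (1 + x) := by
  have h := Real.one_sub_inv_le_log_of_pos (show 0 < 1 + x by linarith)
  have : x / 2 ≤ 1 - (1 + x)⁻¹ := by
    rw [← sub_nonneg]
    have : 1 - (1 + x)⁻¹ - x / 2 = x * (1 - x) / (2 * (1 + x)) := by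
      field_simp
      ring
    rw [this]
    exact div_nonneg (mul_nonneg h0 (by linarith)) (by linarith)
  linarith

/-- The elliptical potential bound for the squared weighted norms. -/
lemma sum_inv_regGram_quadratic_le {n : Type*} [Fintype n] [DecidableEq n] {K : ℕ}
    (φ : Fin K → n → ℝ) (hφ : ∀ i, φ i ⬝ᵥ φ i ≤ 1) :
    ∑ k, φ k ⬝ᵥ (regGram φ (Iio k))⁻¹ *ᵥ φ k ≤ 2 * Real.log (regGram φ univ).det := by
  let f : ℕ → ℝ := fun m => Real.log (regGram φ {i | i.val < m}).det
  have hstep (k : Fin K) : φ k ⬝ᵥ (regGram φ (Iio k))⁻¹ *ᵥ φ k ≤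
      2 * (f (k.val + 1) - f k.val) := by
    have hlt : ({i | i.val < k.val} : Finset (Fin K)) = Iio k := by
      ext i; simp
    have hsucc : ({i | i.val < k.val + 1} : Finset (Fin K)) = insert k (Iio k) := by
      ext i
      simp only [mem_filter, mem_univ, true_and, mem_insert, mem_Iio, Fin.ext_iff, Fin.lt_def]
      omega
    have h0 := inv_regGram_quadratic_nonneg φ (Iio k) (φ k)
    simp only [f]
    rw [hlt, hsucc, det_regGram_insert φ (by simp),
      Real.log_mul (regGram_posDef φ _).det_pos.ne' (by positivity), add_sub_cancel_left]
    exact Real.le_two_mul_log_one_add h0 (inv_regGram_quadratic_le_one φ _ (hφ k))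
  calc _ ≤ ∑ k : Fin K, 2 * (f (k.val + 1) - f k.val) := sum_le_sum fun k _ => hstep k
    _ = 2 * (f K - f 0) := by
      rw [← mul_sum, Fin.sum_univ_eq_sum_range (fun k => f (k + 1) - f k), sum_range_sub]
    _ = _ := by simp [f, regGram]

/-- With `Λ_k = I + ∑_{i<k} φ_i φ_iᵀ` and `‖φ_k‖ ≤ 1`, the sum of the weighted norms
`‖φ_k‖_{Λ_k⁻¹}` over `k = 1,…,K` is at most `2 √(dK log K)`. -/
theorem stmt_15 (d K : ℕ) (hd : 1 ≤ d) (hK : 2 ≤ K)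
    (φ : Fin K → Fin d → ℝ)
    (hφ : ∀ k, Real.sqrt (∑ i, φ k i ^ 2) ≤ 1)
    (Λ : Fin K → Matrix (Fin d) (Fin d) ℝ)
    (hΛ : ∀ k, Λ k = 1 + ∑ i ∈ Finset.Iio k, Matrix.vecMulVec (φ i) (φ i)) :
    ∑ k, Real.sqrt (φ k ⬝ᵥ (Λ k)⁻¹.mulVec (φ k)) ≤
      2 * Real.sqrt (d * K * Real.log K) := by
  have hφ' (k : Fin K) : φ k ⬝ᵥ φ k ≤ 1 := by
    simpa [Real.sqrt_le_iff, dotProduct, sq] using hφ k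
  obtain rfl : Λ = fun k => regGram φ (Iio k) := funext hΛ
  have hdR : (1 : ℝ) ≤ d := by exact_mod_cast hd
  have hKR : (2 : ℝ) ≤ K := by exact_mod_cast hK
  have hlogdet : Real.log (regGram φ univ).det ≤ d * (2 * Real.log K) := by
    have h := (regGram_posDef φ univ).log_det_le (c := 1 + K) (by positivity)
    have htr := trace_regGram_le φ univ hφ'
    simp only [Fintype.card_fin, card_univ] at h htr
    have hdiv : (regGram φ univ).trace / (1 + K) ≤ d := by
      rw [div_le_iff₀ (by positivity)]
      nlinarith
    have hlog : Real.log (1 + K) ≤ 2 * Real.log K := by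
      rw [← Nat.cast_two, ← Real.log_pow]
      exact Real.log_le_log (by positivity) (by nlinarith)
    have := mul_le_mul_of_nonneg_left hlog (Nat.cast_nonneg' d)
    linarith
  have hsum := sum_inv_regGram_quadratic_le φ hφ'
  have hcs := sq_sum_le_card_mul_sum_sq (s := (univ : Finset (Fin K)))
    (f := fun k => Real.sqrt (φ k ⬝ᵥ (regGram φ (Iio k))⁻¹ *ᵥ φ k))
  simp only [Real.sq_sqrt (inv_regGram_quadratic_nonneg φ _ _), card_univ, Fintype.card_fin] at hcs
  have hlog0 : 0 ≤ Real.log K := Real.log_nonneg (by linarith)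
  refine abs_le_of_sq_le_sq' ?_ (by positivity) |>.2
  rw [mul_pow, Real.sq_sqrt (by positivity)]
  calc _ ≤ _ := hcs
    _ ≤ K * (2 * (d * (2 * Real.log K))) := by gcongr; linarith
    _ = _ := by ring
end
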